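/- For each θ∈ℝ and ℓ>0, the function a ↦ R(θ,a,ℓ) is strictly decreasing on (0,∞). Moreover, for every C₀ ≥ 1 there exists a constant C = C(C₀, m) ≥ 1 such that for all θ∈ℝ, a>0, ℓ>0: max_{α ∈ [a/C₀, C₀a]} |∂ₐR(θ,α,ℓ)| ≤ C · min_{α ∈ [a/C₀, C₀a]} |∂ₐR(θ,α,ℓ)|. -/

import Mathlib

noncomputable section

open Real MeasureTheory Set Filter

/-- Japanese bracket `⟨x⟩ := √(2+x²)`. -/
def jb (x : ℝ) : ℝ := Real.sqrt (2 + x ^ 2)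

/-- `κ(a,ℓ) := (1 + 4a²ℓ/m²)^{-1/2}`. -/
def kpa (m a ℓ : ℝ) : ℝ := 1 / Real.sqrt (1 + 4 * a ^ 2 * ℓ / m ^ 2)

/-- `p(a,ℓ) := m / (2a²κ(a,ℓ))`. -/
def pfn (m a ℓ : ℝ) : ℝ := m / (2 * a ^ 2 * kpa m a ℓ)

/-- `r₀(a,ℓ) := p(a,ℓ)(1-κ(a,ℓ))`. -/
def rZero (m a ℓ : ℝ) : ℝ := pfn m a ℓ * (1 - kpa m a ℓ)

/-- `G_κ(y) := √(y²-1) - κ ln(y + √(y²-1))`. -/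
def Gf (κ y : ℝ) : ℝ := Real.sqrt (y ^ 2 - 1) - κ * Real.log (y + Real.sqrt (y ^ 2 - 1))

/-- `H_κ : [0,∞) → [1,∞)`, the inverse of `G_κ` on `[1,∞)`. -/
def Hf (κ x : ℝ) : ℝ := Function.invFunOn (Gf κ) (Set.Ici 1) x

/-- Inverse hyperbolic cosine `arcosh x = ln (x + √(x²-1))`. -/
def acosh (x : ℝ) : ℝ := Real.log (x + Real.sqrt (x ^ 2 - 1))

/-- The radial function `R(θ,a,ℓ)`. -/
def Rf (m θ a ℓ : ℝ) : ℝ :=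
  pfn m a ℓ * Hf (kpa m a ℓ) (|θ| / pfn m a ℓ) - pfn m a ℓ * kpa m a ℓ

/-- The radial velocity `V(θ,a,ℓ)`. -/
def Vf (m θ a ℓ : ℝ) : ℝ :=
  Real.sign θ * a *
    Real.sqrt (1 + m / (a ^ 2 * Rf m θ a ℓ) - ℓ / (a ^ 2 * (Rf m θ a ℓ) ^ 2))

/-- The dynamical radial function `R̃(t,θ,a,ℓ) = R(θ+at,a,ℓ)`. -/
def Rtil (m t θ a ℓ : ℝ) : ℝ := Rf m (θ + a * t) a ℓ

/-- The action `𝒜(r,v,ℓ) = √(v² - m/r + ℓ/r²)`. -/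
def Acal (m r v ℓ : ℝ) : ℝ := Real.sqrt (v ^ 2 - m / r + ℓ / r ^ 2)

/-- The angle `Θ(r,v,ℓ) = sgn(v)·p(𝒜,ℓ)·G_{κ(𝒜,ℓ)}(r/p(𝒜,ℓ) + κ(𝒜,ℓ))`. -/
def Theta (m r v ℓ : ℝ) : ℝ :=
  Real.sign v * pfn m (Acal m r v ℓ) ℓ *
    Gf (kpa m (Acal m r v ℓ) ℓ) (r / pfn m (Acal m r v ℓ) ℓ + kpa m (Acal m r v ℓ) ℓ)

/-- The phase space `ℝ×(0,∞)×(0,∞)` in the variables `(θ,a,ℓ)`. -/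
def phaseSet : Set (ℝ × ℝ × ℝ) := Set.univ ×ˢ Set.Ioi 0 ×ˢ Set.Ioi 0

/-- The gravitational field
`F(t,r) = -(1/r²)·∫∫∫ 1_{R(θ+ta,a,ℓ) ≤ r} γ(θ,a,ℓ)² dθ da dℓ`. -/
def gravF (m : ℝ) (γ : ℝ × ℝ × ℝ → ℝ) (t r : ℝ) : ℝ :=
  -(1 / r ^ 2) *
    (∫⁻ x in {x : ℝ × ℝ × ℝ | Rf m (x.1 + t * x.2.1) x.2.1 x.2.2 ≤ r},
        ENNReal.ofReal ((γ x) ^ 2) ∂(volume.restrict phaseSet)).toReal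

/-- The effective gravitational field
`F_eff(t,r) = -(1/r²)·∫∫∫ 1_{at ≤ r} γ(θ,a,ℓ)² dθ da dℓ`. -/
def gravFeff (γ : ℝ × ℝ × ℝ → ℝ) (t r : ℝ) : ℝ :=
  -(1 / r ^ 2) *
    (∫⁻ x in {x : ℝ × ℝ × ℝ | x.2.1 * t ≤ r},
        ENNReal.ofReal ((γ x) ^ 2) ∂(volume.restrict phaseSet)).toReal

/-- The function `F_κ(u)` with `-a ∂ₐR = p F_κ(u)/(cosh u - κ)`. -/
def Fk (k u : ℝ) : ℝ := 1 + 3 * k ^ 2 - k * (3 + k ^ 2) * cosh u + 2 * k * u * sinh u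

lemma mono_aux (f f' : ℝ → ℝ) (hf : ∀ x, HasDerivAt f (f' x) x) (h0 : f 0 = 0)
    (hp : ∀ x, 0 ≤ x → 0 ≤ f' x) : ∀ x, 0 ≤ x → 0 ≤ f x := by
  intro x hx
  have hm : MonotoneOn f (Set.Ici 0) := by
    apply monotoneOn_of_deriv_nonneg (convex_Ici 0)
    · exact fun y _ => (hf y).continuousAt.continuousWithinAt
    · exact fun y _ => (hf y).differentiableAt.differentiableWithinAt
    · intro y hy
      rw [interior_Ici] at hy
      rw [(hf y).deriv]
      exact hp y (le_of_lt hy)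
  have := hm (Set.mem_Ici.2 le_rfl) (Set.mem_Ici.2 hx) hx
  rwa [h0] at this

lemma hyp1 : ∀ u : ℝ, 0 ≤ u → 0 ≤ u * cosh u - sinh u := by
  apply mono_aux _ (fun u => u * sinh u)
  · intro x
    have h := ((hasDerivAt_id x).mul (hasDerivAt_cosh x)).sub (hasDerivAt_sinh x)
    refine h.congr_deriv ?_
    simp
  · simp
  · intro x hx
    exact mul_nonneg hx (sinh_nonneg_iff.2 hx)

lemma hyp2 : ∀ u : ℝ, 0 ≤ u → 0 ≤ u * sinh u - 2 * (cosh u - 1) := by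
  apply mono_aux _ (fun u => u * cosh u - sinh u)
  · intro x
    have h := ((hasDerivAt_id x).mul (hasDerivAt_sinh x)).sub
      (((hasDerivAt_cosh x).sub_const 1).const_mul 2)
    refine h.congr_deriv ?_
    simp
    ring
  · simp
  · exact hyp1

lemma hyp3 : ∀ u : ℝ, 0 ≤ u → 0 ≤ u * cosh u + 2 * u - 3 * sinh u := by
  apply mono_aux _ (fun u => u * sinh u - 2 * (cosh u - 1))
  · intro x
    have h := (((hasDerivAt_id x).mul (hasDerivAt_cosh x)).add
      ((hasDerivAt_id x).const_mul 2)).sub ((hasDerivAt_sinh x).const_mul 3)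
    refine h.congr_deriv ?_
    simp
    ring
  · simp
  · exact hyp2

lemma hyp4 (u : ℝ) (hu : 0 ≤ u) : sinh u * (sinh u - u) ≤ (cosh u - 1) ^ 2 := by
  have h := hyp2 u hu
  have h2 := cosh_sq u
  nlinarith

lemma hyp5 (u : ℝ) (hu : 0 ≤ u) : (u * cosh u - sinh u) * (sinh u - u) ≤
    2 * (cosh u - 1) * (u * sinh u - 2 * (cosh u - 1)) := by
  rcases hu.eq_or_lt with rfl | hu0
  · simp
  have hs : 0 < sinh u := sinh_pos_iff.2 hu0
  have hc : 1 < cosh u := one_lt_cosh.2 hu0.ne'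
  have h1 := hyp1 u hu
  have h2 := hyp2 u hu
  have h3 := hyp3 u hu
  have h4 := hyp4 u hu
  have hsq := cosh_sq u
  set c := cosh u
  set s := sinh u
  have hA : (u * c - s) * (c - 1) ≤ 2 * s * (u * s - 2 * (c - 1)) := by
    have : 2 * s * (u * s - 2 * (c - 1)) - (u * c - s) * (c - 1)
        = (c - 1) * (u * c + 2 * u - 3 * s) := by
      have : s ^ 2 = c ^ 2 - 1 := by linarith
      linear_combination (2 * u) * this
    nlinarith [mul_nonneg (sub_nonneg.2 hc.le) h3]
  have hB : (u * c - s) * (s * (s - u)) ≤ (u * c - s) * (c - 1) ^ 2 :=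
    mul_le_mul_of_nonneg_left h4 h1
  have hC := mul_le_mul_of_nonneg_left hA (sub_nonneg.2 hc.le)
  have hD : s * ((u * c - s) * (s - u)) ≤ s * (2 * (c - 1) * (u * s - 2 * (c - 1))) := by
    nlinarith
  exact le_of_mul_le_mul_left hD hs

lemma Fk_eq (k u : ℝ) : Fk k u = (1 - k) ^ 3 + k * (1 - k ^ 2) * (cosh u - 1)
    + 2 * (k * (u * sinh u - 2 * (cosh u - 1))) := by
  unfold Fk; ring

lemma Fk_pos (k u : ℝ) (hk : 0 < k) (hk1 : k < 1) (hu : 0 ≤ u) : 0 < Fk k u := by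
  rw [Fk_eq]
  have h1 : 0 < (1 - k) ^ 3 := pow_pos (by linarith) 3
  have h2 : 0 ≤ k * (1 - k ^ 2) * (cosh u - 1) :=
    mul_nonneg (mul_nonneg hk.le (by nlinarith)) (by linarith [one_le_cosh u])
  have h3 := mul_nonneg hk.le (hyp2 u hu)
  linarith

/-- `a ∂ₐ u`. -/
def Du (k u : ℝ) : ℝ := (-2 * k * u + (1 + k ^ 2) * sinh u) / (cosh u - k)

/-- `a ∂ₐ F`. -/
def DF (k u : ℝ) : ℝ := (6 * k - (3 + 3 * k ^ 2) * cosh u + 2 * u * sinh u) * (-(k * (1 - k ^ 2)))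
  + k * (-(1 + k ^ 2) * sinh u + 2 * u * cosh u) * Du k u

lemma Du_bound (k u : ℝ) (hk : 0 < k) (hk1 : k < 1) (hu : 0 ≤ u) :
    0 ≤ Du k u ∧ sinh u * Du k u ≤ 3 * (cosh u - k) := by
  have hc := one_le_cosh u
  have hs : 0 ≤ sinh u := sinh_nonneg_iff.2 hu
  have hsu : u ≤ sinh u := self_le_sinh_iff.2 hu
  have h4 := hyp4 u hu
  have hsq := cosh_sq u
  have hck : 0 < cosh u - k := by linarith
  unfold Du
  set c := cosh u
  set s := sinh u
  have e : -2 * k * u + (1 + k ^ 2) * s = (1 - k) ^ 2 * s + 2 * k * (s - u) := by ring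
  rw [e]
  have hsu' : 0 ≤ s - u := by linarith
  constructor
  · positivity
  · rw [mul_div_assoc', div_le_iff₀ hck]
    have a1 : ((1 - k) * s) ^ 2 ≤ (c - k) ^ 2 := by
      have : (1 - k) * s ≤ c - k := by
        have h0 : s < c := sinh_lt_cosh u
        have h0' := mul_le_mul_of_nonneg_left h0.le (show 0 ≤ 1 - k by linarith)
        have h0'' := mul_nonneg hk.le (show 0 ≤ c - 1 by linarith)
        linarith
      exact pow_le_pow_left₀ (mul_nonneg (by linarith) hs) this 2
    have a2 : (c - 1) ^ 2 ≤ (c - k) ^ 2 := pow_le_pow_left₀ (by linarith) (by linarith) 2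
    have a3 : k * (s * (s - u)) ≤ 1 * (s * (s - u)) :=
      mul_le_mul_of_nonneg_right hk1.le (mul_nonneg hs hsu')
    nlinarith

set_option maxHeartbeats 1000000 in
lemma DF_bound (k u : ℝ) (hk : 0 < k) (hk1 : k < 1) (hu : 0 ≤ u) :
    |DF k u| ≤ 14 * Fk k u := by
  have hc := one_le_cosh u
  have hs : 0 ≤ sinh u := sinh_nonneg_iff.2 hu
  have hsu : u ≤ sinh u := self_le_sinh_iff.2 hu
  have h1 := hyp1 u hu
  have h2 := hyp2 u hu
  have h4 := hyp4 u hu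
  have h5 := hyp5 u hu
  have hsq := cosh_sq u
  have hck : 0 < cosh u - k := by linarith
  rw [Fk_eq]
  unfold DF Du
  set c := cosh u
  set s := sinh u
  obtain ⟨E, hE⟩ : ∃ E, E = u * s - 2 * (c - 1) := ⟨_, rfl⟩
  obtain ⟨Q, hQ⟩ : ∃ Q, Q = u * c - s := ⟨_, rfl⟩
  obtain ⟨d, hd⟩ : ∃ d, d = s - u := ⟨_, rfl⟩
  rw [← hE] at h2 h5 ⊢
  rw [← hQ] at h1 h5
  rw [← hd] at h4 h5
  have hd0 : 0 ≤ d := by linarith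
  have hk2 : 0 ≤ 1 - k ^ 2 := by nlinarith
  have hk3 : 0 ≤ 1 - k := by linarith
  have hX : 0 ≤ (1 - k) ^ 3 := by positivity
  have hc1 : 0 ≤ c - 1 := by linarith
  have hY : 0 ≤ k * (1 - k ^ 2) * (c - 1) := by positivity
  have hZ : 0 ≤ k * E := by positivity
  -- first part
  have p1 : |(6 * k - (3 + 3 * k ^ 2) * c + 2 * u * s) * (-(k * (1 - k ^ 2)))| ≤
      6 * (1 - k) ^ 3 + 2 * (k * (1 - k ^ 2) * (c - 1)) + 2 * (k * E) := by
    have e : (6 * k - (3 + 3 * k ^ 2) * c + 2 * u * s) * (-(k * (1 - k ^ 2)))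
      = 3 * ((k * (1 + k)) * (1 - k) ^ 3) - (1 - 3 * k ^ 2) * (k * (1 - k ^ 2) * (c - 1))
        - 2 * ((1 - k ^ 2) * (k * E)) := by rw [hE]; ring
    rw [e]
    have b1 : (k * (1 + k)) * (1 - k) ^ 3 ≤ 2 * (1 - k) ^ 3 :=
      mul_le_mul_of_nonneg_right (by nlinarith) hX
    have b1' : 0 ≤ (k * (1 + k)) * (1 - k) ^ 3 := by positivity
    have b2 : (1 - 3 * k ^ 2) * (k * (1 - k ^ 2) * (c - 1)) ≤ 2 * (k * (1 - k ^ 2) * (c - 1)) :=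
      mul_le_mul_of_nonneg_right (by nlinarith) hY
    have b2' : (-2) * (k * (1 - k ^ 2) * (c - 1)) ≤
        (1 - 3 * k ^ 2) * (k * (1 - k ^ 2) * (c - 1)) :=
      mul_le_mul_of_nonneg_right (by nlinarith) hY
    have b3 : (1 - k ^ 2) * (k * E) ≤ 1 * (k * E) :=
      mul_le_mul_of_nonneg_right (by nlinarith) hZ
    have b3' : 0 ≤ (1 - k ^ 2) * (k * E) := by positivity
    rw [abs_le]
    constructor <;> linarith
  -- second part
  have e2 : k * (-(1 + k ^ 2) * s + 2 * u * c) * ((-2 * k * u + (1 + k ^ 2) * s) / (c - k))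
      = (k * ((1 - k ^ 2) * s + 2 * Q) * ((1 - k) ^ 2 * s + 2 * k * d)) / (c - k) := by
    rw [mul_div_assoc']; congr 1; rw [hQ, hd]; ring
  have p2 : 0 ≤ k * (-(1 + k ^ 2) * s + 2 * u * c) *
      ((-2 * k * u + (1 + k ^ 2) * s) / (c - k)) := by
    rw [e2]; positivity
  have p3 : k * (-(1 + k ^ 2) * s + 2 * u * c) * ((-2 * k * u + (1 + k ^ 2) * s) / (c - k)) ≤
      8 * (k * (1 - k ^ 2) * (c - 1)) + 12 * (k * E) := by
    rw [e2, div_le_iff₀ hck]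
    have t1 : k * (1 - k ^ 2) * ((1 - k) ^ 2 * s ^ 2) ≤
        2 * (k * (1 - k ^ 2) * (c - 1)) * (c - k) := by
      have : (1 - k) ^ 2 * s ^ 2 ≤ 2 * (c - 1) * (c - k) := by
        have e : s ^ 2 = (c - 1) * (c + 1) := by linarith
        rw [e]
        have i1 : (1 - k) ^ 2 * (c + 1) ≤ 2 * (c - k) := by nlinarith
        have j0 := mul_le_mul_of_nonneg_left i1 hc1
        linarith
      have j3 := mul_le_mul_of_nonneg_left this (mul_nonneg hk.le hk2)
      linarith
    have t2 : 2 * k ^ 2 * (1 - k ^ 2) * (s * d) ≤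
        2 * (k * (1 - k ^ 2) * (c - 1)) * (c - k) := by
      have i1 : k * (s * d) ≤ (c - 1) * (c - k) := by
        have : k * (s * d) ≤ 1 * (s * d) := mul_le_mul_of_nonneg_right hk1.le (by positivity)
        have j2 := mul_nonneg hc1 hk3
        linarith
      have j3 := mul_le_mul_of_nonneg_left i1 (mul_nonneg hk.le hk2)
      linarith
    have t3 : 2 * k * (1 - k) ^ 2 * (s * Q) ≤
        (4 * (k * (1 - k ^ 2) * (c - 1)) + 4 * (k * E)) * (c - k) := by
      have i1 : s * Q ≤ 2 * c * (c - 1 + E) := by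
        rw [hE, hQ]
        rw [hE] at h2
        have j0 := mul_nonneg (show 0 ≤ c by linarith) h2
        have j1 := sq_nonneg s
        linarith
      have i2 : (1 - k) * c ≤ c - k := by nlinarith
      have i3 : (1 - k) * (s * Q) ≤ 2 * (c - k) * (c - 1 + E) := by
        have j1 := mul_le_mul_of_nonneg_left i1 hk3
        have j2 := mul_le_mul_of_nonneg_right i2 (show 0 ≤ c - 1 + E by linarith)
        linarith
      have i4 : 2 * k * (1 - k) * ((1 - k) * (s * Q)) ≤
          2 * k * (1 - k) * (2 * (c - k) * (c - 1 + E)) :=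
        mul_le_mul_of_nonneg_left i3 (by positivity)
      have i5 : (1 - k) * (k * (c - 1)) ≤ (1 - k ^ 2) * (k * (c - 1)) :=
        mul_le_mul_of_nonneg_right (by nlinarith) (by positivity)
      have i6 : (1 - k) * (k * E) ≤ 1 * (k * E) :=
        mul_le_mul_of_nonneg_right (by linarith) hZ
      have i7 : 4 * ((1 - k) * (k * (c - 1)) + (1 - k) * (k * E)) * (c - k) ≤
        4 * ((1 - k ^ 2) * (k * (c - 1)) + 1 * (k * E)) * (c - k) :=
        mul_le_mul_of_nonneg_right (by linarith) hck.le
      linarith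
    have t4 : 4 * k ^ 2 * (Q * d) ≤ 8 * (k * E) * (c - k) := by
      have i1 : k * (Q * d) ≤ 1 * (Q * d) := mul_le_mul_of_nonneg_right hk1.le (by positivity)
      have i2 : 2 * (c - 1) * E ≤ 2 * (c - k) * E :=
        mul_le_mul_of_nonneg_right (by linarith) h2
      have i3 : k * (k * (Q * d)) ≤ k * (2 * (c - k) * E) :=
        mul_le_mul_of_nonneg_left (by linarith) hk.le
      linarith
    linarith
  rw [abs_le] at p1 ⊢
  constructor <;> linarith [p1.1, p1.2]

lemma M_bound (k u : ℝ) (hk : 0 < k) (hk1 : k < 1) (hu : 0 ≤ u) :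
    |-(1 + k ^ 2) + DF k u / Fk k u
      - (sinh u * Du k u - (-(k * (1 - k ^ 2)))) / (cosh u - k)| ≤ 21 := by
  have hF := Fk_pos k u hk hk1 hu
  have hDF := DF_bound k u hk hk1 hu
  obtain ⟨hD0, hD⟩ := Du_bound k u hk hk1 hu
  have hck : 0 < cosh u - k := by linarith [one_le_cosh u]
  have hs : 0 ≤ sinh u := sinh_nonneg_iff.2 hu
  have b1 : |DF k u / Fk k u| ≤ 14 := by
    rw [abs_div, abs_of_pos hF, div_le_iff₀ hF]; exact hDF
  have hk2 : 0 ≤ k * (1 - k ^ 2) := mul_nonneg hk.le (by nlinarith)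
  have b2 : (sinh u * Du k u - (-(k * (1 - k ^ 2)))) / (cosh u - k) ≤ 5 := by
    rw [div_le_iff₀ hck]
    have : k * (1 - k ^ 2) ≤ 2 * (1 - k) := by
      have : k * (1 + k) * (1 - k) ≤ 2 * (1 - k) :=
        mul_le_mul_of_nonneg_right (by nlinarith) (by linarith)
      nlinarith
    nlinarith [one_le_cosh u]
  have b3 : 0 ≤ (sinh u * Du k u - (-(k * (1 - k ^ 2)))) / (cosh u - k) := by
    have := mul_nonneg hs hD0
    apply div_nonneg _ hck.le
    linarith
  rw [abs_le] at b1 ⊢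
  constructor <;> nlinarith [b1.1, b1.2]

lemma kpa_pos (m a ℓ : ℝ) (hl : 0 < ℓ) : 0 < kpa m a ℓ := by
  unfold kpa; positivity

lemma kpa_sq (m a ℓ : ℝ) (hl : 0 < ℓ) : kpa m a ℓ ^ 2 * (1 + 4 * a ^ 2 * ℓ / m ^ 2) = 1 := by
  unfold kpa
  have : 0 < 1 + 4 * a ^ 2 * ℓ / m ^ 2 := by positivity
  rw [div_pow, sq_sqrt this.le]
  field_simp

lemma kpa_lt (m a ℓ : ℝ) (hm : 0 < m) (ha : 0 < a) (hl : 0 < ℓ) : kpa m a ℓ < 1 := by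
  have h := kpa_sq m a ℓ hl
  have hp := kpa_pos m a ℓ hl
  have hb : 0 < 4 * a ^ 2 * ℓ / m ^ 2 := by positivity
  by_contra hcon
  push Not at hcon
  nlinarith [mul_pos (pow_pos hp 2) hb]

lemma pfn_pos (m a ℓ : ℝ) (hm : 0 < m) (ha : 0 < a) (hl : 0 < ℓ) : 0 < pfn m a ℓ := by
  have hp := kpa_pos m a ℓ hl
  unfold pfn; positivity

lemma kpa_contDiffAt (m a ℓ : ℝ) (hl : 0 < ℓ) :
    ContDiffAt ℝ 1 (fun x => kpa m x ℓ) a := by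
  have : 0 < 1 + 4 * a ^ 2 * ℓ / m ^ 2 := by positivity
  have h1 : ContDiffAt ℝ 1 (fun x : ℝ => 1 + 4 * x ^ 2 * ℓ / m ^ 2) a := by fun_prop
  unfold kpa
  exact contDiffAt_const.div (h1.sqrt this.ne') (by positivity)

lemma pfn_contDiffAt (m a ℓ : ℝ) (ha : 0 < a) (hl : 0 < ℓ) :
    ContDiffAt ℝ 1 (fun x => pfn m x ℓ) a := by
  have hp := kpa_pos m a ℓ hl
  have h1 : ContDiffAt ℝ 1 (fun x : ℝ => 2 * x ^ 2) a := by fun_prop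
  unfold pfn
  exact contDiffAt_const.div (h1.mul (kpa_contDiffAt m a ℓ hl)) (by positivity)

lemma kpa_hasDerivAt (m a ℓ : ℝ) (hm : 0 < m) (ha : 0 < a) (hl : 0 < ℓ) :
    HasDerivAt (fun x => kpa m x ℓ) (-(kpa m a ℓ * (1 - kpa m a ℓ ^ 2)) / a) a := by
  have hd := ((kpa_contDiffAt m a ℓ hl).differentiableAt (by norm_num)).hasDerivAt
  set k' := deriv (fun x => kpa m x ℓ) a
  have hp := kpa_pos m a ℓ hl
  have hq : HasDerivAt (fun x : ℝ => 1 + 4 * x ^ 2 * ℓ / m ^ 2) (4 * (2 * a) * ℓ / m ^ 2) a := by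
    have := ((((hasDerivAt_pow 2 a).const_mul 4).mul_const ℓ).div_const (m ^ 2)).const_add 1
    refine this.congr_deriv ?_
    simp
  have h2 := (hd.pow 2).mul hq
  have h3 : HasDerivAt (fun x : ℝ => kpa m x ℓ ^ 2 * (1 + 4 * x ^ 2 * ℓ / m ^ 2)) 0 a := by
    have : (fun x : ℝ => kpa m x ℓ ^ 2 * (1 + 4 * x ^ 2 * ℓ / m ^ 2)) = fun _ => 1 := by
      funext x; exact kpa_sq m x ℓ hl
    rw [this]; exact hasDerivAt_const _ _
  have h4 := h2.unique h3
  have h5 := kpa_sq m a ℓ hl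
  refine hd.congr_deriv ?_
  simp at h4
  set k := kpa m a ℓ
  rw [eq_div_iff ha.ne']
  have e1 : 4 * (2 * a) * ℓ / m ^ 2 * a = 2 * (4 * a ^ 2 * ℓ / m ^ 2) := by ring
  set b := 4 * a ^ 2 * ℓ / m ^ 2
  have h6 : 2 * k * k' * a * (1 + b) + k ^ 2 * (2 * b) = 0 := by
    rw [← e1]; linear_combination a * h4
  have h7 : k * (1 + b) * (k' * a + k * (1 - k ^ 2)) = 0 := by
    linear_combination h6 / 2 + k^2 * (-1) * h5
  have hb : 0 < b := by positivity
  have := (mul_eq_zero.1 h7).resolve_left (by positivity)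
  linarith

lemma pfn_hasDerivAt (m a ℓ : ℝ) (hm : 0 < m) (ha : 0 < a) (hl : 0 < ℓ) :
    HasDerivAt (fun x => pfn m x ℓ) (-(pfn m a ℓ * (1 + kpa m a ℓ ^ 2)) / a) a := by
  have hp := kpa_pos m a ℓ hl
  have h1 := ((hasDerivAt_pow 2 a).const_mul 2).mul (kpa_hasDerivAt m a ℓ hm ha hl)
  have h2 := (hasDerivAt_const a m).div h1 (by simp; exact ⟨ha.ne', hp.ne'⟩)
  refine h2.congr_deriv ?_
  simp
  unfold pfn
  set k := kpa m a ℓ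
  field_simp
  ring

lemma Gf_cosh (k u : ℝ) (hu : 0 ≤ u) : Gf k (cosh u) = sinh u - k * u := by
  unfold Gf
  have h : cosh u ^ 2 - 1 = sinh u ^ 2 := by rw [cosh_sq]; ring
  rw [h, sqrt_sq (sinh_nonneg_iff.2 hu), cosh_add_sinh, log_exp]

lemma psi_strictMono (k : ℝ) (hk : 0 < k) (hk1 : k < 1) : StrictMono (fun u => sinh u - k * u) := by
  apply strictMono_of_hasDerivAt_pos (f' := fun u => cosh u - k)
  · intro x
    have := (hasDerivAt_sinh x).sub ((hasDerivAt_id x).const_mul k)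
    refine this.congr_deriv ?_
    simp
  · intro x
    linarith [one_le_cosh x]

lemma psi_surj (k x : ℝ) (hk : 0 < k) (hk1 : k < 1) (hx : 0 ≤ x) :
    ∃ u, 0 ≤ u ∧ sinh u - k * u = x := by
  have hy : 0 ≤ x / (1 - k) := div_nonneg hx (by linarith)
  have hcont : ContinuousOn (fun u => sinh u - k * u) (Set.Icc 0 (x / (1 - k))) := by
    apply Continuous.continuousOn
    have := continuous_sinh
    fun_prop
  have := intermediate_value_Icc hy hcont
  have hmem : x ∈ Set.Icc (sinh 0 - k * 0) (sinh (x / (1 - k)) - k * (x / (1 - k))) := by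
    constructor
    · simpa using hx
    · have h1 : x / (1 - k) ≤ sinh (x / (1 - k)) := self_le_sinh_iff.2 hy
      have h2 : (1 - k) * (x / (1 - k)) = x := by
        have : (1 - k) ≠ 0 := by linarith
        field_simp
      linarith
  obtain ⟨u, hu, hux⟩ := this hmem
  exact ⟨u, hu.1, hux⟩

/-- The eccentric anomaly. -/
def Uf (m θ a ℓ : ℝ) : ℝ := Real.arcosh (Hf (kpa m a ℓ) (|θ| / pfn m a ℓ))

lemma Uf_spec (m θ a ℓ : ℝ) (hm : 0 < m) (ha : 0 < a) (hl : 0 < ℓ) :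
    0 ≤ Uf m θ a ℓ ∧ cosh (Uf m θ a ℓ) = Hf (kpa m a ℓ) (|θ| / pfn m a ℓ) ∧
    pfn m a ℓ * (sinh (Uf m θ a ℓ) - kpa m a ℓ * Uf m θ a ℓ) = |θ| := by
  have hk := kpa_pos m a ℓ hl
  have hk1 := kpa_lt m a ℓ hm ha hl
  have hp := pfn_pos m a ℓ hm ha hl
  have hx : 0 ≤ |θ| / pfn m a ℓ := by positivity
  obtain ⟨v, hv, hvx⟩ := psi_surj _ _ hk hk1 hx
  have hex : ∃ y ∈ Set.Ici (1 : ℝ), Gf (kpa m a ℓ) y = |θ| / pfn m a ℓ :=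
    ⟨cosh v, one_le_cosh v, by rw [Gf_cosh _ _ hv, hvx]⟩
  have h1 : 1 ≤ Hf (kpa m a ℓ) (|θ| / pfn m a ℓ) := Function.invFunOn_mem hex
  have h2 : Gf (kpa m a ℓ) (Hf (kpa m a ℓ) (|θ| / pfn m a ℓ)) = |θ| / pfn m a ℓ :=
    Function.invFunOn_eq hex
  have h3 : cosh (Uf m θ a ℓ) = Hf (kpa m a ℓ) (|θ| / pfn m a ℓ) := Real.cosh_arcosh h1
  have h0 : 0 ≤ Uf m θ a ℓ := Real.arcosh_nonneg h1
  refine ⟨h0, h3, ?_⟩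
  rw [← h3, Gf_cosh _ _ h0] at h2
  rw [h2]
  field_simp

lemma Rf_eq (m θ a ℓ : ℝ) (hm : 0 < m) (ha : 0 < a) (hl : 0 < ℓ) :
    Rf m θ a ℓ = pfn m a ℓ * (cosh (Uf m θ a ℓ) - kpa m a ℓ) := by
  rw [(Uf_spec m θ a ℓ hm ha hl).2.1]
  unfold Rf; ring

lemma Uf_differentiableAt (m θ a ℓ : ℝ) (hm : 0 < m) (ha : 0 < a) (hl : 0 < ℓ) :
    DifferentiableAt ℝ (fun x => Uf m θ x ℓ) a := by
  have hk := kpa_pos m a ℓ hl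
  have hk1 := kpa_lt m a ℓ hm ha hl
  have hp := pfn_pos m a ℓ hm ha hl
  obtain ⟨hu0, -, hu⟩ := Uf_spec m θ a ℓ hm ha hl
  set u := Uf m θ a ℓ with hudef
  let f : ℝ × ℝ → ℝ := fun z => pfn m z.1 ℓ * (sinh z.2 - kpa m z.1 ℓ * z.2)
  have hf : ContDiffAt ℝ 1 f (a, u) := by
    have c1 : ContDiffAt ℝ 1 (fun z : ℝ × ℝ => pfn m z.1 ℓ) (a, u) :=
      ContDiffAt.comp (g := fun x => pfn m x ℓ) (a, u) (pfn_contDiffAt m a ℓ ha hl) contDiffAt_fst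
    have c2 : ContDiffAt ℝ 1 (fun z : ℝ × ℝ => kpa m z.1 ℓ) (a, u) :=
      ContDiffAt.comp (g := fun x => kpa m x ℓ) (a, u) (kpa_contDiffAt m a ℓ hl) contDiffAt_fst
    have c3 : ContDiffAt ℝ 1 (fun z : ℝ × ℝ => sinh z.2) (a, u) :=
      (contDiffAt_snd).sinh
    exact c1.mul (c3.sub (c2.mul contDiffAt_snd))
  have hs : HasStrictFDerivAt f (fderiv ℝ f (a, u)) (a, u) := hf.hasStrictFDerivAt (by norm_num)
  have hval : (fderiv ℝ f (a, u) ∘L .inr ℝ ℝ ℝ) 1 = pfn m a ℓ * (cosh u - kpa m a ℓ) := by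
    have e1 : HasDerivAt (fun v => f (a, v)) ((fderiv ℝ f (a, u)) (0, 1)) u := by
      have := hs.hasFDerivAt.comp_hasDerivAt u ((hasDerivAt_const u a).prodMk (hasDerivAt_id u))
      exact this
    have e2 : HasDerivAt (fun v => f (a, v)) (pfn m a ℓ * (cosh u - kpa m a ℓ)) u := by
      have := ((hasDerivAt_sinh u).sub ((hasDerivAt_id u).const_mul (kpa m a ℓ))).const_mul
        (pfn m a ℓ)
      refine this.congr_deriv ?_
      simp
    have := e1.unique e2
    simpa using this
  have hne : pfn m a ℓ * (cosh u - kpa m a ℓ) ≠ 0 :=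
    mul_ne_zero hp.ne' (by linarith [one_le_cosh u])
  have hinv : (fderiv ℝ f (a, u) ∘L .inr ℝ ℝ ℝ).IsInvertible := by
    refine ⟨ContinuousLinearEquiv.unitsEquivAut ℝ (Units.mk0 _ hne), ?_⟩
    ext
    rw [hval]
    simp
  have hd := (hs.hasStrictFDerivAt_implicitFunctionOfProdDomain hinv).hasFDerivAt.differentiableAt
  have hev := hs.eventually_apply_implicitFunctionOfProdDomain hinv
  refine hd.congr_of_eventuallyEq ?_
  filter_upwards [hev, lt_mem_nhds ha] with x hx hx0
  have hxu := (Uf_spec m θ x ℓ hm hx0 hl).2.2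
  have hpx := pfn_pos m x ℓ hm hx0 hl
  have hmono := psi_strictMono _ (kpa_pos m x ℓ hl) (kpa_lt m x ℓ hm hx0 hl)
  apply hmono.injective
  apply mul_left_cancel₀ hpx.ne'
  refine hxu.trans ?_
  rw [← hu]
  exact hx.symm

lemma Uf_hasDerivAt (m θ a ℓ : ℝ) (hm : 0 < m) (ha : 0 < a) (hl : 0 < ℓ) :
    HasDerivAt (fun x => Uf m θ x ℓ) (Du (kpa m a ℓ) (Uf m θ a ℓ) / a) a := by
  have hd := (Uf_differentiableAt m θ a ℓ hm ha hl).hasDerivAt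
  set u' := deriv (fun x => Uf m θ x ℓ) a
  have h1 := (pfn_hasDerivAt m a ℓ hm ha hl).mul
    (hd.sinh.sub ((kpa_hasDerivAt m a ℓ hm ha hl).mul hd))
  have h2 := h1.congr_of_eventuallyEq (f₁ := fun _ => |θ|) (by
    filter_upwards [lt_mem_nhds ha] with x hx
    exact (Uf_spec m θ x ℓ hm hx hl).2.2.symm)
  have h3 := h2.unique (hasDerivAt_const a |θ|)
  refine hd.congr_deriv ?_
  have hk := kpa_pos m a ℓ hl
  have hk1 := kpa_lt m a ℓ hm ha hl
  have hp := pfn_pos m a ℓ hm ha hl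
  have hck : cosh (Uf m θ a ℓ) - kpa m a ℓ ≠ 0 := by linarith [one_le_cosh (Uf m θ a ℓ)]
  simp at h3
  unfold Du
  set u := Uf m θ a ℓ
  set k := kpa m a ℓ
  set p := pfn m a ℓ
  rw [div_div, eq_div_iff (mul_ne_zero hck ha.ne')]
  field_simp at h3
  apply mul_left_cancel₀ hp.ne'
  linear_combination h3

/-- `-a ∂ₐ R`. -/
def Nf (m θ ℓ a : ℝ) : ℝ :=
  pfn m a ℓ * Fk (kpa m a ℓ) (Uf m θ a ℓ) / (cosh (Uf m θ a ℓ) - kpa m a ℓ)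

lemma Nf_pos (m θ a ℓ : ℝ) (hm : 0 < m) (ha : 0 < a) (hl : 0 < ℓ) : 0 < Nf m θ ℓ a := by
  have hk := kpa_pos m a ℓ hl
  have hk1 := kpa_lt m a ℓ hm ha hl
  have hp := pfn_pos m a ℓ hm ha hl
  have hck : 0 < cosh (Uf m θ a ℓ) - kpa m a ℓ := by linarith [one_le_cosh (Uf m θ a ℓ)]
  exact div_pos (mul_pos hp (Fk_pos _ _ hk hk1 (Uf_spec m θ a ℓ hm ha hl).1)) hck

lemma Rf_hasDerivAt (m θ a ℓ : ℝ) (hm : 0 < m) (ha : 0 < a) (hl : 0 < ℓ) :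
    HasDerivAt (fun x => Rf m θ x ℓ) (-(Nf m θ ℓ a / a)) a := by
  have hu := Uf_hasDerivAt m θ a ℓ hm ha hl
  have h1 := (pfn_hasDerivAt m a ℓ hm ha hl).mul (hu.cosh.sub (kpa_hasDerivAt m a ℓ hm ha hl))
  have h2 := h1.congr_of_eventuallyEq (f₁ := fun x => Rf m θ x ℓ) (by
    filter_upwards [lt_mem_nhds ha] with x hx
    exact Rf_eq m θ x ℓ hm hx hl)
  refine h2.congr_deriv ?_
  have hk1 := kpa_lt m a ℓ hm ha hl
  have hck : cosh (Uf m θ a ℓ) - kpa m a ℓ ≠ 0 := by linarith [one_le_cosh (Uf m θ a ℓ)]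
  have hsq := cosh_sq (Uf m θ a ℓ)
  unfold Nf Du Fk
  simp only [Pi.sub_apply]
  set u := Uf m θ a ℓ
  set k := kpa m a ℓ
  set p := pfn m a ℓ
  set c := cosh u
  set s := sinh u
  have hs2 : s ^ 2 = c ^ 2 - 1 := by linarith
  field_simp
  ring_nf
  rw [hs2]
  ring

lemma logN_hasDerivAt (m θ a ℓ : ℝ) (hm : 0 < m) (ha : 0 < a) (hl : 0 < ℓ) :
    ∃ M, |M| ≤ 21 ∧ HasDerivAt (fun x => log (Nf m θ ℓ x)) (M / a) a := by
  have hu0 := (Uf_spec m θ a ℓ hm ha hl).1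
  have hk := kpa_pos m a ℓ hl
  have hk1 := kpa_lt m a ℓ hm ha hl
  have hp := pfn_pos m a ℓ hm ha hl
  have hck : 0 < cosh (Uf m θ a ℓ) - kpa m a ℓ := by linarith [one_le_cosh (Uf m θ a ℓ)]
  have hF := Fk_pos _ _ hk hk1 hu0
  refine ⟨_, M_bound _ _ hk hk1 hu0, ?_⟩
  have hdu := Uf_hasDerivAt m θ a ℓ hm ha hl
  have hdk := kpa_hasDerivAt m a ℓ hm ha hl
  have hdp := pfn_hasDerivAt m a ℓ hm ha hl
  have hdF : HasDerivAt (fun x => Fk (kpa m x ℓ) (Uf m θ x ℓ))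
      (DF (kpa m a ℓ) (Uf m θ a ℓ) / a) a := by
    have := ((((hdk.pow 2).const_mul 3).const_add 1).sub
      ((hdk.mul ((hdk.pow 2).const_add 3)).mul hdu.cosh)).add
      (((hdk.const_mul 2).mul hdu).mul hdu.sinh)
    refine this.congr_deriv ?_
    simp
    unfold DF
    generalize Du (kpa m a ℓ) (Uf m θ a ℓ) = D
    field_simp
    ring
  have h := ((hdp.log hp.ne').add (hdF.log hF.ne')).sub ((hdu.cosh.sub hdk).log hck.ne')
  have h2 := h.congr_of_eventuallyEq (f₁ := fun x => log (Nf m θ ℓ x)) (by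
    filter_upwards [lt_mem_nhds ha] with x hx
    have hk := kpa_pos m x ℓ hl
    have hk1 := kpa_lt m x ℓ hm hx hl
    have hp := pfn_pos m x ℓ hm hx hl
    have hck : 0 < cosh (Uf m θ x ℓ) - kpa m x ℓ := by linarith [one_le_cosh (Uf m θ x ℓ)]
    have hF := Fk_pos _ _ hk hk1 (Uf_spec m θ x ℓ hm hx hl).1
    unfold Nf
    rw [log_div (mul_pos hp hF).ne' hck.ne', log_mul hp.ne' hF.ne']
    rfl)
  refine h2.congr_deriv ?_
  simp only [Pi.sub_apply]
  generalize DF (kpa m a ℓ) (Uf m θ a ℓ) = D at *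
  generalize Du (kpa m a ℓ) (Uf m θ a ℓ) = D' at *
  generalize Fk (kpa m a ℓ) (Uf m θ a ℓ) = F at *
  have hck' := hck.ne'
  field_simp

lemma N_comp (m θ ℓ : ℝ) (hm : 0 < m) (hl : 0 < ℓ) (x y : ℝ) (hx : 0 < x) (hy : 0 < y) :
    Nf m θ ℓ x ≤ exp (21 * |log x - log y|) * Nf m θ ℓ y := by
  have hder : ∀ t : ℝ, ∃ M, |M| ≤ 21 ∧ HasDerivAt (fun t => log (Nf m θ ℓ (exp t))) M t := by
    intro t
    obtain ⟨M, hM, h⟩ := logN_hasDerivAt m θ (exp t) ℓ hm (exp_pos t) hl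
    refine ⟨M, hM, ?_⟩
    have := h.comp t (Real.hasDerivAt_exp t)
    refine this.congr_deriv ?_
    field_simp
  choose g hg hgd using hder
  have := Convex.norm_image_sub_le_of_norm_hasDerivWithin_le (s := Set.univ)
    (f := fun t => log (Nf m θ ℓ (exp t))) (f' := g) (C := 21)
    (fun t _ => (hgd t).hasDerivWithinAt) (fun t _ => hg t) convex_univ
    (Set.mem_univ (log y)) (Set.mem_univ (log x))
  simp only [exp_log hx, exp_log hy, Real.norm_eq_abs] at this
  have hNx := Nf_pos m θ x ℓ hm hx hl
  have hNy := Nf_pos m θ y ℓ hm hy hl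
  have h1 := (abs_le.1 this).2
  have h2 : log (Nf m θ ℓ x) ≤ 21 * |log x - log y| + log (Nf m θ ℓ y) := by linarith
  have h3 := exp_le_exp.2 h2
  rwa [exp_add, exp_log hNx, exp_log hNy] at h3

/-- `a ↦ R(θ,a,ℓ)` is strictly decreasing, and `|∂ₐR|` takes comparable values
on compact multiplicative intervals of actions. -/
theorem statement11 (m : ℝ) (hm : 0 < m) :
    (∀ θ ℓ : ℝ, 0 < ℓ → StrictAntiOn (fun a => Rf m θ a ℓ) (Set.Ioi 0)) ∧
    ∀ C₀ : ℝ, 1 ≤ C₀ → ∃ C : ℝ, 1 ≤ C ∧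
      ∀ θ a ℓ : ℝ, 0 < a → 0 < ℓ →
        ∀ α₁ α₂ : ℝ, α₁ ∈ Set.Icc (a / C₀) (C₀ * a) → α₂ ∈ Set.Icc (a / C₀) (C₀ * a) →
          |deriv (fun a' => Rf m θ a' ℓ) α₁| ≤ C * |deriv (fun a' => Rf m θ a' ℓ) α₂| := by
  constructor
  · intro θ ℓ hl
    apply strictAntiOn_of_deriv_neg (convex_Ioi 0)
    · exact fun a ha => (Rf_hasDerivAt m θ a ℓ hm ha hl).continuousAt.continuousWithinAt
    · intro a ha
      rw [interior_Ioi] at ha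
      rw [(Rf_hasDerivAt m θ a ℓ hm ha hl).deriv]
      have := div_pos (Nf_pos m θ a ℓ hm ha hl) ha
      linarith
  · intro C₀ hC
    have hC0 : 0 < C₀ := by linarith
    have hlC : 0 ≤ log C₀ := log_nonneg hC
    refine ⟨exp (21 * (2 * log C₀)) * C₀ ^ 2, ?_, ?_⟩
    · have h1 : 1 ≤ exp (21 * (2 * log C₀)) := one_le_exp (by positivity)
      have h2 : 1 ≤ C₀ ^ 2 := one_le_pow₀ hC
      nlinarith
    · intro θ a ℓ ha hl x y hx hy
      have hac : 0 < a / C₀ := by positivity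
      have hx0 : 0 < x := lt_of_lt_of_le hac hx.1
      have hy0 : 0 < y := lt_of_lt_of_le hac hy.1
      have hNx := Nf_pos m θ x ℓ hm hx0 hl
      have hNy := Nf_pos m θ y ℓ hm hy0 hl
      rw [(Rf_hasDerivAt m θ x ℓ hm hx0 hl).deriv, (Rf_hasDerivAt m θ y ℓ hm hy0 hl).deriv,
        abs_neg, abs_neg, abs_of_pos (div_pos hNx hx0), abs_of_pos (div_pos hNy hy0)]
      have hlog : ∀ z, z ∈ Set.Icc (a / C₀) (C₀ * a) →
          log a - log C₀ ≤ log z ∧ log z ≤ log C₀ + log a := by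
        intro z hz
        have hz0 : 0 < z := lt_of_lt_of_le hac hz.1
        constructor
        · rw [← log_div ha.ne' hC0.ne']
          exact log_le_log hac hz.1
        · rw [← log_mul hC0.ne' ha.ne']
          exact log_le_log hz0 hz.2
      have hd : |log x - log y| ≤ 2 * log C₀ := by
        rw [abs_le]
        constructor <;> linarith [(hlog x hx).1, (hlog x hx).2, (hlog y hy).1, (hlog y hy).2]
      have h1 := N_comp m θ ℓ hm hl x y hx0 hy0
      have h2 : exp (21 * |log x - log y|) ≤ exp (21 * (2 * log C₀)) :=
        exp_le_exp.2 (by linarith)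
      have h3 : Nf m θ ℓ x ≤ exp (21 * (2 * log C₀)) * Nf m θ ℓ y :=
        h1.trans (mul_le_mul_of_nonneg_right h2 hNy.le)
      have h4 : y ≤ C₀ ^ 2 * x := by
        have i1 : a ≤ x * C₀ := (div_le_iff₀ hC0).1 hx.1
        have i2 := mul_le_mul_of_nonneg_left i1 hC0.le
        linarith [hy.2]
      rw [mul_div_assoc', div_le_div_iff₀ hx0 hy0]
      have h5 := mul_le_mul h3 h4 hy0.le (by positivity)
      linarith
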